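/- arXiv:2207.03921 — 2 statements merged into one kernel-verified Lean document; each statement's English description precedes it below -/
import Mathlib

section
/- Let s ∈ (0,1), δ > 0, and set c_{s,δ} := (2 − 2s)/(π δ^{2−2s}). Let u : ℝ² → ℝ be a polynomial of total degree at most 3. Then for every x ∈ ℝ², the principal value exists and lim_{ε→0⁺} 2 c_{s,δ} ∫_{{y : ε ≤ |y−x|₂ ≤ δ}} (u(x) − u(y)) / |x−y|₂^{2+2s} dy = −Δu(x), i.e., the correctly scaled truncated fractional-type diffusion operator coincides with the classical negative Laplacian on polynomials of degree up to three. -/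
open MeasureTheory Filter

/-- The Laplacian on `ℝ²` (Euclidean space), as a sum of second directional derivatives. -/
noncomputable def laplacian2 (u : EuclideanSpace ℝ (Fin 2) → ℝ)
    (x : EuclideanSpace ℝ (Fin 2)) : ℝ :=
  ∑ i : Fin 2,
    fderiv ℝ (fun z => fderiv ℝ u z (EuclideanSpace.single i 1)) x (EuclideanSpace.single i 1)

/-- The differential of a polynomial function is given by the formal partial derivatives. -/
theorem MvPolynomial.hasFDerivAt_eval_euclidean {ι : Type*} [Fintype ι]
    (p : MvPolynomial ι ℝ) (x : EuclideanSpace ℝ ι) :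
    HasFDerivAt (fun z : EuclideanSpace ℝ ι => MvPolynomial.eval (fun i => z i) p)
      (∑ i, MvPolynomial.eval (fun j => x j) (MvPolynomial.pderiv i p) •
        (EuclideanSpace.proj i : EuclideanSpace ℝ ι →L[ℝ] ℝ)) x := by
  classical
  induction p using MvPolynomial.induction_on with
  | C a => simpa using hasFDerivAt_const a x
  | add p q hp hq =>
    simp only [map_add, add_smul, Finset.sum_add_distrib]
    exact hp.add hq
  | mul_X p n hp =>
    have hX : HasFDerivAt (fun z : EuclideanSpace ℝ ι => z n)
        (EuclideanSpace.proj n : EuclideanSpace ℝ ι →L[ℝ] ℝ) x :=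
      (EuclideanSpace.proj n : EuclideanSpace ℝ ι →L[ℝ] ℝ).hasFDerivAt
    have h := hp.mul hX
    simp only [map_mul, MvPolynomial.eval_X]
    refine h.congr_fderiv ?_
    ext v
    simp [MvPolynomial.pderiv_X, add_mul, Finset.sum_add_distrib,
      Finset.mul_sum, Pi.single_apply, apply_ite, ite_mul]
    exact Finset.sum_congr rfl fun i _ => by ring

theorem MvPolynomial.fderiv_eval_single {ι : Type*} [Fintype ι] [DecidableEq ι]
    (p : MvPolynomial ι ℝ) (x : EuclideanSpace ℝ ι) (i : ι) :
    fderiv ℝ (fun z : EuclideanSpace ℝ ι => MvPolynomial.eval (fun i => z i) p) x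
      (EuclideanSpace.single i 1) =
      MvPolynomial.eval (fun j => x j) (MvPolynomial.pderiv i p) := by
  rw [(MvPolynomial.hasFDerivAt_eval_euclidean p x).fderiv]
  simp

theorem laplacian2_eval (p : MvPolynomial (Fin 2) ℝ) (x : EuclideanSpace ℝ (Fin 2)) :
    laplacian2 (fun z => MvPolynomial.eval (fun i => z i) p) x =
      ∑ i, MvPolynomial.eval (fun j => x j)
        (MvPolynomial.pderiv i (MvPolynomial.pderiv i p)) := by
  simp only [laplacian2, MvPolynomial.fderiv_eval_single]

/-- Rotation of the Euclidean plane by a right angle. -/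
noncomputable def rightAngleRotation2 :
    EuclideanSpace ℝ (Fin 2) ≃ₗᵢ[ℝ] EuclideanSpace ℝ (Fin 2) where
  toFun v := !₂[-v 1, v 0]
  invFun v := !₂[v 1, -v 0]
  map_add' v w := by ext i; fin_cases i <;> simp [add_comm]
  map_smul' r v := by ext i; fin_cases i <;> simp
  left_inv v := by ext i; fin_cases i <;> simp
  right_inv v := by ext i; fin_cases i <;> simp
  norm_map' v := by simp [EuclideanSpace.norm_eq, Fin.sum_univ_two, add_comm]

theorem rightAngleRotation2_apply (v : EuclideanSpace ℝ (Fin 2)) :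
    rightAngleRotation2 v = !₂[-v 1, v 0] := rfl

/-- The five-point formula for the Laplacian, exact on polynomials of degree at most three. -/
theorem MvPolynomial.sum_eval_square_of_totalDegree_le_three (p : MvPolynomial (Fin 2) ℝ)
    (hp : p.totalDegree ≤ 3) (x h : Fin 2 → ℝ) :
    MvPolynomial.eval (x + h) p + MvPolynomial.eval (x - h) p
      + MvPolynomial.eval (x + ![-h 1, h 0]) p + MvPolynomial.eval (x - ![-h 1, h 0]) p =
      4 * MvPolynomial.eval x p + (h 0 ^ 2 + h 1 ^ 2) *
        ∑ i, MvPolynomial.eval x (MvPolynomial.pderiv i (MvPolynomial.pderiv i p)) := by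
  have key : ∀ d ∈ p.support, ∀ a : ℝ,
      MvPolynomial.eval (x + h) (monomial d a) + MvPolynomial.eval (x - h) (monomial d a)
      + MvPolynomial.eval (x + ![-h 1, h 0]) (monomial d a)
      + MvPolynomial.eval (x - ![-h 1, h 0]) (monomial d a) =
      4 * MvPolynomial.eval x (monomial d a) + (h 0 ^ 2 + h 1 ^ 2) *
        ∑ i, MvPolynomial.eval x (MvPolynomial.pderiv i (MvPolynomial.pderiv i (monomial d a))) := by
    intro d hd a
    have hdeg : d 0 + d 1 ≤ 3 := by
      have := (MvPolynomial.le_totalDegree hd).trans hp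
      rwa [Finsupp.sum_fintype _ _ (by simp), Fin.sum_univ_two] at this
    simp only [MvPolynomial.pderiv_monomial, MvPolynomial.eval_monomial,
      Finsupp.prod_fintype _ _ (fun _ => pow_zero _), Fin.sum_univ_two, Fin.prod_univ_two,
      Pi.add_apply, Pi.sub_apply, Finsupp.tsub_apply, Finsupp.single_apply]
    generalize d 0 = m at hdeg ⊢
    generalize d 1 = n at hdeg ⊢
    have hm : m ≤ 3 := by omega
    have hn : n ≤ 3 := by omega
    interval_cases m <;> interval_cases n <;> first | omega | (simp; try ring)
  rw [p.as_sum]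
  simp only [map_sum]
  rw [Finset.sum_comm, ← Finset.sum_add_distrib, ← Finset.sum_add_distrib,
    ← Finset.sum_add_distrib, Finset.mul_sum, Finset.mul_sum, ← Finset.sum_add_distrib]
  exact Finset.sum_congr rfl fun d hd => key d hd _

theorem integral_radial_mul_sub_cubic (p : MvPolynomial (Fin 2) ℝ) (hp : p.totalDegree ≤ 3)
    (u : EuclideanSpace ℝ (Fin 2) → ℝ) (hu : ∀ x, u x = MvPolynomial.eval (fun i => x i) p)
    (x : EuclideanSpace ℝ (Fin 2)) (w : ℝ → ℝ)
    (hw : Integrable fun h : EuclideanSpace ℝ (Fin 2) => w ‖h‖ * (u x - u (x + h))) :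
    ∫ h : EuclideanSpace ℝ (Fin 2), w ‖h‖ * (u x - u (x + h)) =
      -(laplacian2 u x / 4) * ∫ h : EuclideanSpace ℝ (Fin 2), w ‖h‖ * ‖h‖ ^ 2 := by
  set g := fun h : EuclideanSpace ℝ (Fin 2) => w ‖h‖ * (u x - u (x + h)) with hg
  have hsum : ∀ h, g h + g (-h) + (g (rightAngleRotation2 h) + g (-rightAngleRotation2 h)) =
      -laplacian2 u x * (w ‖h‖ * ‖h‖ ^ 2) := by
    intro h
    have hΔ : laplacian2 u x = _ := (congrArg (laplacian2 · x) (funext hu)).trans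
      (laplacian2_eval p x)
    have h4 := MvPolynomial.sum_eval_square_of_totalDegree_le_three p hp (fun i => x i)
      (fun i => h i)
    have hn : ‖h‖ ^ 2 = h 0 ^ 2 + h 1 ^ 2 := by
      simp [EuclideanSpace.norm_sq_eq, Fin.sum_univ_two]
    have e1 : u (x + h) = MvPolynomial.eval ((fun i => x i) + fun i => h i) p := hu _
    have e2 : u (x + -h) = MvPolynomial.eval ((fun i => x i) - fun i => h i) p := by
      rw [← sub_eq_add_neg]; exact hu _
    have e3 : u (x + rightAngleRotation2 h) =
        MvPolynomial.eval ((fun i => x i) + ![-h 1, h 0]) p := hu _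
    have e4 : u (x + -rightAngleRotation2 h) =
        MvPolynomial.eval ((fun i => x i) - ![-h 1, h 0]) p := by
      rw [← sub_eq_add_neg]; exact hu _
    simp only [hg, norm_neg, LinearIsometryEquiv.norm_map]
    rw [e1, e2, e3, e4, hn, hΔ, hu x]
    linear_combination (-w ‖h‖) * h4
  have hrot {f : EuclideanSpace ℝ (Fin 2) → ℝ} (hf : Integrable f) :
      Integrable (fun h => f (rightAngleRotation2 h)) :=
    rightAngleRotation2.measurePreserving.integrable_comp_of_integrable hf
  have irot (f : EuclideanSpace ℝ (Fin 2) → ℝ) :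
      ∫ h, f (rightAngleRotation2 h) = ∫ h, f h :=
    rightAngleRotation2.measurePreserving.integral_comp
      rightAngleRotation2.toHomeomorph.measurableEmbedding f
  have hneg : Integrable fun h => g (-h) := hw.comp_neg
  have hint := integral_congr_ae (μ := volume) (Filter.Eventually.of_forall hsum)
  have hsplit : ∫ h, (g h + g (-h) + (g (rightAngleRotation2 h) + g (-rightAngleRotation2 h))) =
      (∫ h, (g h + g (-h))) + ∫ h, (g (rightAngleRotation2 h) + g (-rightAngleRotation2 h)) :=
    integral_add (hw.add hneg) ((hrot hw).add (hrot hneg))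
  rw [hsplit, integral_add hw hneg,
    integral_add (hrot hw) (hrot hneg), irot g, irot fun h => g (-h), integral_neg_eq_self,
    integral_const_mul] at hint
  linarith

theorem integral_annulus_rpow_mul_norm_sq {s ε δ : ℝ} (hs : s < 1) (hε : 0 < ε) (hεδ : ε ≤ δ) :
    ∫ h : EuclideanSpace ℝ (Fin 2),
      (Set.Icc ε δ).indicator (fun r => (r ^ (2 + 2 * s))⁻¹) ‖h‖ * ‖h‖ ^ 2 =
      2 * Real.pi * ((δ ^ (2 - 2 * s) - ε ^ (2 - 2 * s)) / (2 - 2 * s)) := by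
  rw [integral_fun_norm_addHaar volume
    (fun r => (Set.Icc ε δ).indicator (fun r => (r ^ (2 + 2 * s))⁻¹) r * r ^ 2)]
  have hvol : volume.real (Metric.ball (0 : EuclideanSpace ℝ (Fin 2)) 1) = Real.pi := by
    simp [measureReal_def, EuclideanSpace.volume_ball_fin_two, Real.pi_pos.le]
  have hrad : ∫ y in Set.Ioi (0 : ℝ),
      y ^ (2 - 1) • ((Set.Icc ε δ).indicator (fun r => (r ^ (2 + 2 * s))⁻¹) y * y ^ 2) =
      (δ ^ (2 - 2 * s) - ε ^ (2 - 2 * s)) / (2 - 2 * s) := by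
    have hind : ∀ y ∈ Set.Ioi (0 : ℝ),
        y ^ (2 - 1) • ((Set.Icc ε δ).indicator (fun r => (r ^ (2 + 2 * s))⁻¹) y * y ^ 2) =
        (Set.Icc ε δ).indicator (fun r => r ^ (1 - 2 * s)) y := by
      intro y hy
      have hy : 0 < y := hy
      by_cases hm : y ∈ Set.Icc ε δ
      · rw [smul_eq_mul, Set.indicator_of_mem hm, Set.indicator_of_mem hm, ← Real.rpow_neg hy.le,
          ← Real.rpow_natCast, ← Real.rpow_natCast, ← Real.rpow_add hy, ← Real.rpow_add hy]
        congr 1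
        push_cast
        ring
      · simp [hm]
    have hsub : Set.Icc ε δ ⊆ Set.Ioi 0 := fun y hy => hε.trans_le hy.1
    rw [setIntegral_congr_fun measurableSet_Ioi hind, setIntegral_indicator measurableSet_Icc,
      Set.inter_eq_self_of_subset_right hsub, integral_Icc_eq_integral_Ioc,
      ← intervalIntegral.integral_of_le hεδ, integral_rpow (Or.inl (by linarith))]
    ring_nf
  rw [finrank_euclideanSpace_fin, hvol, hrad]
  simp only [smul_eq_mul, nsmul_eq_mul, Nat.cast_ofNat, mul_assoc]

theorem integrable_annulus_rpow_mul {r ε δ : ℝ} (hε : 0 < ε)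
    {f : EuclideanSpace ℝ (Fin 2) → ℝ} (hf : Continuous f) :
    Integrable fun h : EuclideanSpace ℝ (Fin 2) =>
      (Set.Icc ε δ).indicator (fun t => (t ^ r)⁻¹) ‖h‖ * f h := by
  have hclosed : IsClosed ((‖·‖) ⁻¹' Set.Icc ε δ : Set (EuclideanSpace ℝ (Fin 2))) :=
    isClosed_Icc.preimage continuous_norm
  have hcpt : IsCompact ((‖·‖) ⁻¹' Set.Icc ε δ : Set (EuclideanSpace ℝ (Fin 2))) :=
    (isCompact_closedBall (0 : EuclideanSpace ℝ (Fin 2)) δ).of_isClosed_subset hclosed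
      fun h hh => by simpa using hh.2
  have hcont : ContinuousOn (fun h : EuclideanSpace ℝ (Fin 2) => (‖h‖ ^ r)⁻¹ * f h)
      ((‖·‖) ⁻¹' Set.Icc ε δ) := by
    intro h hh
    have hpos : 0 < ‖h‖ := hε.trans_le hh.1
    exact (((continuous_norm.continuousAt.rpow_const (Or.inl hpos.ne')).inv₀
      (Real.rpow_pos_of_pos hpos r).ne').mul hf.continuousAt).continuousWithinAt
  refine ((integrable_indicator_iff hclosed.measurableSet).2
    (hcont.integrableOn_compact hcpt)).congr (Filter.Eventually.of_forall fun h => ?_)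
  by_cases hh : ‖h‖ ∈ Set.Icc ε δ
  · simp [Set.indicator, hh.1, hh.2]
  · simp only [Set.indicator, Set.mem_preimage, hh, if_false, zero_mul]

/-- the correctly scaled truncated fractional-type diffusion operator
coincides with the classical negative Laplacian on polynomials of degree up to three;
the principal value is the limit over the annuli `{ε ≤ |y-x|₂ ≤ δ}` as `ε → 0⁺`. -/
theorem truncated_fractional_on_cubics
    (s δ : ℝ) (hs : s ∈ Set.Ioo (0:ℝ) 1) (hδ : 0 < δ)
    (c : ℝ) (hc : c = (2 - 2*s) / (Real.pi * δ ^ (2 - 2*s)))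
    (p : MvPolynomial (Fin 2) ℝ) (hp : p.totalDegree ≤ 3)
    (u : EuclideanSpace ℝ (Fin 2) → ℝ)
    (hu : ∀ x, u x = MvPolynomial.eval (fun i => x i) p)
    (x : EuclideanSpace ℝ (Fin 2)) :
    Tendsto (fun ε : ℝ =>
        2 * c * ∫ y in {y : EuclideanSpace ℝ (Fin 2) | ε ≤ dist y x ∧ dist y x ≤ δ},
          (u x - u y) / dist x y ^ (2 + 2*s))
      (nhdsWithin 0 (Set.Ioi 0)) (nhds (- laplacian2 u x)) := by
  have hs1 : 0 < 2 - 2 * s := by linarith [hs.2]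
  have hδs : 0 < δ ^ (2 - 2 * s) := Real.rpow_pos_of_pos hδ _
  have hucont : Continuous u := by
    rw [funext hu, continuous_iff_continuousAt]
    exact fun z => (MvPolynomial.hasFDerivAt_eval_euclidean p z).continuousAt
  have hval : ∀ ε ∈ Set.Ioc 0 δ,
      -laplacian2 u x * (1 - ε ^ (2 - 2 * s) / δ ^ (2 - 2 * s)) =
      2 * c * ∫ y in {y : EuclideanSpace ℝ (Fin 2) | ε ≤ dist y x ∧ dist y x ≤ δ},
          (u x - u y) / dist x y ^ (2 + 2*s) := by
    intro ε hε
    have hmeas : MeasurableSet {y : EuclideanSpace ℝ (Fin 2) | ε ≤ dist y x ∧ dist y x ≤ δ} :=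
      measurableSet_Icc.preimage (continuous_id.dist continuous_const).measurable
    have htrans : ∫ y in {y : EuclideanSpace ℝ (Fin 2) | ε ≤ dist y x ∧ dist y x ≤ δ},
          (u x - u y) / dist x y ^ (2 + 2*s) =
        ∫ h : EuclideanSpace ℝ (Fin 2),
          (Set.Icc ε δ).indicator (fun r => (r ^ (2 + 2 * s))⁻¹) ‖h‖ * (u x - u (x + h)) := by
      rw [← integral_indicator hmeas, ← integral_add_left_eq_self _ x]
      congr 1 with h
      by_cases hh : ‖h‖ ∈ Set.Icc ε δ
      · simp [Set.indicator, hh.1, hh.2, div_eq_inv_mul]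
      · have : ¬ (ε ≤ ‖h‖ ∧ ‖h‖ ≤ δ) := hh
        simp [Set.indicator, this]
    rw [htrans, integral_radial_mul_sub_cubic p hp u hu x _ (integrable_annulus_rpow_mul hε.1
      (continuous_const.sub (hucont.comp (continuous_const.add continuous_id)))),
      integral_annulus_rpow_mul_norm_sq hs.2 hε.1 hε.2, hc]
    have := Real.pi_pos
    generalize δ ^ (2 - 2 * s) = a at hδs ⊢
    generalize ε ^ (2 - 2 * s) = b
    generalize 2 - 2 * s = q at hs1 ⊢
    field_simp
    ring
  have hpow : Tendsto (fun ε : ℝ => ε ^ (2 - 2 * s)) (nhdsWithin 0 (Set.Ioi 0)) (nhds 0) := by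
    have h := (Real.continuousAt_rpow_const 0 (2 - 2 * s) (Or.inr hs1.le)).tendsto
    rw [Real.zero_rpow hs1.ne'] at h
    exact h.mono_left nhdsWithin_le_nhds
  have hlim := ((hpow.div_const (δ ^ (2 - 2 * s))).const_sub 1).const_mul (-laplacian2 u x)
  rw [zero_div, sub_zero, mul_one] at hlim
  exact hlim.congr' (Filter.mem_of_superset (Ioc_mem_nhdsGT hδ) hval)
end

section
/- Let s ∈ (0,1) and let u : ℝ² → ℝ be three times continuously differentiable with bounded third derivatives. For δ > 0 set c_{s,δ} := (2 − 2s)/(π δ^{2−2s}) and define (−L_δ^s u)(x) := lim_{ε→0⁺} 2 c_{s,δ} ∫_{{y : ε ≤ |y−x|₂ ≤ δ}} (u(x) − u(y))/|x−y|₂^{2+2s} dy (the principal value exists). Then for every x ∈ ℝ², lim_{δ→0⁺} (−L_δ^s u)(x) = −Δu(x), i.e., the correctly scaled truncated fractional-type diffusion operator converges pointwise to the classical negative Laplacian as the horizon δ vanishes. -/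
open MeasureTheory Filter

/-- Second-order Taylor expansion with Peano remainder, without symmetry of the second derivative. -/
theorem taylor_two_le {E : Type*} [NormedAddCommGroup E] [NormedSpace ℝ E] {u : E → ℝ}
    (hu : Differentiable ℝ u) {x : E} (hu' : DifferentiableAt ℝ (fderiv ℝ u) x)
    {η : ℝ} (hη : 0 < η) :
    ∃ r > 0, ∀ h : E, ‖h‖ < r →
      |u (x + h) - u x - fderiv ℝ u x h - fderiv ℝ (fderiv ℝ u) x h h / 2| ≤ η * ‖h‖ ^ 2 := by
  set B := fderiv ℝ (fderiv ℝ u) x with hB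
  have h1 := hasFDerivAt_iff_isLittleO_nhds_zero.1 hu'.hasFDerivAt
  obtain ⟨r, hr, hball⟩ := Metric.eventually_nhds_iff.1 (h1.def hη)
  refine ⟨r, hr, fun h hh => ?_⟩
  let φ : ℝ → ℝ := fun t => u (x + t • h) - u x - t * fderiv ℝ u x h - t ^ 2 * (B h h / 2)
  have hφ : ∀ t : ℝ, HasDerivAt φ
      (fderiv ℝ u (x + t • h) h - fderiv ℝ u x h - t * B h h) t := by
    intro t
    have h2 : HasDerivAt (fun t : ℝ => x + t • h) h t := by
      simpa using ((hasDerivAt_id t).smul_const h).const_add x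
    have h3 := (hu (x + t • h)).hasFDerivAt.comp_hasDerivAt t h2
    have h4 := ((h3.sub_const (u x)).sub
      ((hasDerivAt_id t).mul_const (fderiv ℝ u x h))).sub
      (((hasDerivAt_id t).pow 2).mul_const (B h h / 2))
    refine h4.congr_deriv ?_
    simp
    ring
  have h5 := norm_image_sub_le_of_norm_deriv_le_segment_01'
    (f := φ) (C := η * ‖h‖ ^ 2) (fun t _ => (hφ t).hasDerivWithinAt) (fun t ht => by
      have ht1 : ‖t • h‖ ≤ ‖h‖ := by
        rw [norm_smul, Real.norm_of_nonneg ht.1]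
        nlinarith [norm_nonneg h, ht.2]
      have h6 := hball (y := t • h) (by simpa using ht1.trans_lt hh)
      have h7 : fderiv ℝ u (x + t • h) h - fderiv ℝ u x h - t * B h h =
          (fderiv ℝ u (x + t • h) - fderiv ℝ u x - B (t • h)) h := by simp
      rw [h7]
      calc _ ≤ _ := ContinuousLinearMap.le_opNorm _ _
        _ ≤ (η * ‖h‖) * ‖h‖ := by gcongr; exact h6.trans (by gcongr)
        _ = _ := by ring)
  simpa [φ, mul_comm] using h5

/-- Rotation of the Euclidean plane by a right angle. -/
noncomputable def quarterTurn : EuclideanSpace ℝ (Fin 2) ≃ₗᵢ[ℝ] EuclideanSpace ℝ (Fin 2) :=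
  LinearIsometry.toLinearIsometryEquiv
    { toFun := fun h => !₂[-h 1, h 0]
      map_add' := fun a b => by ext i; fin_cases i <;> (simp; try ring)
      map_smul' := fun a b => by ext i; fin_cases i <;> simp
      norm_map' := fun a => by simp [EuclideanSpace.norm_eq, Fin.sum_univ_two, add_comm] } rfl

theorem quarterTurn_apply (h : EuclideanSpace ℝ (Fin 2)) : quarterTurn h = !₂[-h 1, h 0] := rfl

theorem quarterTurn_quarterTurn (h : EuclideanSpace ℝ (Fin 2)) :
    quarterTurn (quarterTurn h) = -h := by
  ext i; fin_cases i <;> simp [quarterTurn_apply]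

theorem bilin_add_bilin_quarterTurn
    (B : EuclideanSpace ℝ (Fin 2) →L[ℝ] EuclideanSpace ℝ (Fin 2) →L[ℝ] ℝ)
    (h : EuclideanSpace ℝ (Fin 2)) :
    B h h + B (quarterTurn h) (quarterTurn h) =
      (∑ i : Fin 2, B (EuclideanSpace.single i 1) (EuclideanSpace.single i 1)) * ‖h‖ ^ 2 := by
  have key : ∀ v : EuclideanSpace ℝ (Fin 2),
      v = v 0 • EuclideanSpace.single 0 1 + v 1 • EuclideanSpace.single 1 1 := by
    intro v; ext i; fin_cases i <;> simp
  have expand : ∀ v : EuclideanSpace ℝ (Fin 2), B v v =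
      v 0 * v 0 * B (EuclideanSpace.single 0 1) (EuclideanSpace.single 0 1) +
      v 0 * v 1 * B (EuclideanSpace.single 0 1) (EuclideanSpace.single 1 1) +
      v 1 * v 0 * B (EuclideanSpace.single 1 1) (EuclideanSpace.single 0 1) +
      v 1 * v 1 * B (EuclideanSpace.single 1 1) (EuclideanSpace.single 1 1) := by
    intro v
    conv_lhs => rw [key v]
    simp only [map_add, map_smul, add_apply, smul_apply, smul_eq_mul]
    ring
  rw [expand h, expand (quarterTurn h), EuclideanSpace.real_norm_sq_eq]
  simp [quarterTurn_apply, Fin.sum_univ_two]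
  ring

theorem laplacian2_eq_sum_fderiv_fderiv {u : EuclideanSpace ℝ (Fin 2) → ℝ}
    {x : EuclideanSpace ℝ (Fin 2)} (hu' : DifferentiableAt ℝ (fderiv ℝ u) x) :
    laplacian2 u x = ∑ i : Fin 2, fderiv ℝ (fderiv ℝ u) x
      (EuclideanSpace.single i 1) (EuclideanSpace.single i 1) := by
  refine Finset.sum_congr rfl fun i _ => ?_
  rw [fderiv_clm_apply hu' (differentiableAt_const _)]
  simp

/-- The five-point difference of `u` at `x` along the orthogonal directions `h` and its
quarter turn. -/
noncomputable def crossDiff (u : EuclideanSpace ℝ (Fin 2) → ℝ) (x h : EuclideanSpace ℝ (Fin 2)) :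
    ℝ :=
  u (x + h) + u (x + quarterTurn h) + u (x + -h) + u (x + -quarterTurn h) - 4 * u x

theorem crossDiff_zero (u : EuclideanSpace ℝ (Fin 2) → ℝ) (x : EuclideanSpace ℝ (Fin 2)) :
    crossDiff u x 0 = 0 := by
  simp [crossDiff]; ring

theorem continuous_crossDiff {u : EuclideanSpace ℝ (Fin 2) → ℝ} (hu : Continuous u)
    (x : EuclideanSpace ℝ (Fin 2)) : Continuous (crossDiff u x) := by
  have := quarterTurn.continuous
  unfold crossDiff
  fun_prop

theorem crossDiff_sub_laplacian2_le {u : EuclideanSpace ℝ (Fin 2) → ℝ}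
    (hu : Differentiable ℝ u) {x : EuclideanSpace ℝ (Fin 2)}
    (hu' : DifferentiableAt ℝ (fderiv ℝ u) x) {η : ℝ} (hη : 0 < η) :
    ∃ r > 0, ∀ h : EuclideanSpace ℝ (Fin 2), ‖h‖ < r →
      |crossDiff u x h - laplacian2 u x * ‖h‖ ^ 2| ≤ η * ‖h‖ ^ 2 := by
  obtain ⟨r, hr, H⟩ := taylor_two_le hu hu' (η := η / 4) (by positivity)
  refine ⟨r, hr, fun h hh => ?_⟩
  have hJ : ‖quarterTurn h‖ = ‖h‖ := quarterTurn.norm_map h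
  have a1 := H h hh
  have a2 := H (-h) (by simpa using hh)
  have a3 := H (quarterTurn h) (by simpa using hh)
  have a4 := H (-quarterTurn h) (by simpa using hh)
  have hB := bilin_add_bilin_quarterTurn (fderiv ℝ (fderiv ℝ u) x) h
  rw [← laplacian2_eq_sum_fderiv_fderiv hu'] at hB
  simp only [map_neg, neg_apply, norm_neg, neg_neg, hJ] at a1 a2 a3 a4
  rw [abs_le] at *
  unfold crossDiff
  constructor <;> linarith [a1.1, a1.2, a2.1, a2.2, a3.1, a3.2, a4.1, a4.2]

theorem crossDiff_le_on_closedBall {u : EuclideanSpace ℝ (Fin 2) → ℝ}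
    (hu : Differentiable ℝ u) {x : EuclideanSpace ℝ (Fin 2)}
    (hu' : DifferentiableAt ℝ (fderiv ℝ u) x) (δ : ℝ) :
    ∃ C, 0 ≤ C ∧ ∀ h ∈ Metric.closedBall (0 : EuclideanSpace ℝ (Fin 2)) δ,
      |crossDiff u x h| ≤ C * ‖h‖ ^ 2 := by
  obtain ⟨r, hr, H⟩ := crossDiff_sub_laplacian2_le hu hu' one_pos
  obtain ⟨D, hD⟩ := (isCompact_closedBall (0 : EuclideanSpace ℝ (Fin 2)) δ).exists_bound_of_continuousOn
    (continuous_crossDiff hu.continuous x).continuousOn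
  refine ⟨max (1 + |laplacian2 u x|) (D / r ^ 2), le_max_of_le_left (by positivity),
    fun h hh => ?_⟩
  rcases lt_or_ge ‖h‖ r with hlt | hge
  · have h1 := H h hlt
    have h2 : |crossDiff u x h| ≤ (1 + |laplacian2 u x|) * ‖h‖ ^ 2 := by
      have h3 : |laplacian2 u x * ‖h‖ ^ 2| = |laplacian2 u x| * ‖h‖ ^ 2 := by
        rw [abs_mul, abs_of_nonneg (sq_nonneg ‖h‖)]
      have h4 := abs_sub_abs_le_abs_sub (crossDiff u x h) (laplacian2 u x * ‖h‖ ^ 2)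
      linarith
    exact h2.trans (by gcongr; exact le_max_left _ _)
  · have h1 : |crossDiff u x h| ≤ D := hD h hh
    have hD0 : 0 ≤ D := (abs_nonneg _).trans h1
    calc |crossDiff u x h| ≤ D := h1
      _ = D / r ^ 2 * r ^ 2 := by field_simp
      _ ≤ max (1 + |laplacian2 u x|) (D / r ^ 2) * ‖h‖ ^ 2 := by
        gcongr; exact le_max_right _ _

theorem sq_div_rpow_eq {a s : ℝ} (ha : 0 < a) : a ^ 2 / a ^ (2 + 2 * s) = a ^ (-(2 * s)) := by
  rw [Real.rpow_add ha, Real.rpow_neg ha.le, Real.rpow_two]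
  have := Real.rpow_pos_of_pos ha (2 * s)
  field_simp

section RadialIntegral

variable {s δ : ℝ}

theorem closedBall_indicator_norm (h : EuclideanSpace ℝ (Fin 2)) :
    (Metric.closedBall (0 : EuclideanSpace ℝ (Fin 2)) δ).indicator
      (fun h => ‖h‖ ^ (-(2 * s))) h =
    (Set.Iic δ).indicator (fun t : ℝ => t ^ (-(2 * s))) ‖h‖ := by
  simp [Set.indicator, Metric.mem_closedBall]

theorem radial_profile_eqOn :
    Set.EqOn (fun t : ℝ => t ^ (Module.finrank ℝ (EuclideanSpace ℝ (Fin 2)) - 1) •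
      (Set.Iic δ).indicator (fun t : ℝ => t ^ (-(2 * s))) t)
      ((Set.Iic δ).indicator fun t : ℝ => t ^ (1 - 2 * s)) (Set.Ioi 0) := by
  intro t ht
  have h1 : t ^ (1 - 2 * s) = t * t ^ (-(2 * s)) := by
    rw [sub_eq_add_neg, Real.rpow_add ht, Real.rpow_one]
  by_cases h : t ≤ δ <;> simp [Set.indicator, h, h1]

theorem integrableOn_norm_rpow_closedBall (hs : s < 1) (hδ : 0 ≤ δ) :
    IntegrableOn (fun h : EuclideanSpace ℝ (Fin 2) => ‖h‖ ^ (-(2 * s)))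
      (Metric.closedBall 0 δ) := by
  rw [← integrable_indicator_iff measurableSet_closedBall]
  simp_rw [funext closedBall_indicator_norm]
  rw [integrable_fun_norm_addHaar volume
    (f := (Set.Iic δ).indicator fun t : ℝ => t ^ (-(2 * s))),
    integrableOn_congr_fun radial_profile_eqOn measurableSet_Ioi, IntegrableOn,
    integrable_indicator_iff measurableSet_Iic, IntegrableOn,
    Measure.restrict_restrict measurableSet_Iic, Set.inter_comm, Set.Ioi_inter_Iic]
  exact (intervalIntegrable_iff_integrableOn_Ioc_of_le hδ).1
    (intervalIntegral.intervalIntegrable_rpow' (by linarith))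

theorem integral_norm_rpow_closedBall (hs : s < 1) (hδ : 0 ≤ δ) :
    ∫ h in Metric.closedBall (0 : EuclideanSpace ℝ (Fin 2)) δ, ‖h‖ ^ (-(2 * s)) =
      2 * Real.pi * (δ ^ (2 - 2 * s) / (2 - 2 * s)) := by
  rw [← integral_indicator measurableSet_closedBall]
  simp_rw [funext closedBall_indicator_norm]
  rw [integral_fun_norm_addHaar volume
    ((Set.Iic δ).indicator fun t : ℝ => t ^ (-(2 * s))),
    setIntegral_congr_fun measurableSet_Ioi radial_profile_eqOn,
    integral_indicator measurableSet_Iic,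
    Measure.restrict_restrict measurableSet_Iic, Set.inter_comm, Set.Ioi_inter_Iic,
    ← intervalIntegral.integral_of_le hδ, integral_rpow (Or.inl (by linarith)),
    Measure.real, EuclideanSpace.volume_ball_fin_two]
  rw [Real.zero_rpow (by linarith)]
  simp [Real.pi_nonneg, show 1 - 2 * s + 1 = 2 - 2 * s by ring]
  ring

end RadialIntegral

theorem integral_annulus_eq_crossDiff {u : EuclideanSpace ℝ (Fin 2) → ℝ} (hu : Continuous u)
    (x : EuclideanSpace ℝ (Fin 2)) (p : ℝ) {ε : ℝ} (hε : 0 < ε) (δ : ℝ) :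
    ∫ y in {y : EuclideanSpace ℝ (Fin 2) | ε ≤ dist y x ∧ dist y x ≤ δ},
      (u x - u y) / dist x y ^ p =
    -(1 / 4) * ∫ h in {h : EuclideanSpace ℝ (Fin 2) | ε ≤ ‖h‖ ∧ ‖h‖ ≤ δ},
      crossDiff u x h / ‖h‖ ^ p := by
  set N := {h : EuclideanSpace ℝ (Fin 2) | ε ≤ ‖h‖ ∧ ‖h‖ ≤ δ} with hN
  let g : EuclideanSpace ℝ (Fin 2) → ℝ := fun h => (u x - u (x + h)) / ‖h‖ ^ p
  have hshift : ∫ y in {y : EuclideanSpace ℝ (Fin 2) | ε ≤ dist y x ∧ dist y x ≤ δ},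
      (u x - u y) / dist x y ^ p = ∫ h in N, g h := by
    rw [← (measurePreserving_add_left volume x).setIntegral_preimage_emb
      (MeasurableEquiv.addLeft x).measurableEmbedding]
    simp [g, hN, dist_eq_norm, Set.preimage]
  have hrot : ∀ R : EuclideanSpace ℝ (Fin 2) ≃ₗᵢ[ℝ] EuclideanSpace ℝ (Fin 2),
      ∫ h in N, g (R h) = ∫ h in N, g h := by
    intro R
    rw [← R.measurePreserving.setIntegral_preimage_emb
      R.toMeasurableEquiv.measurableEmbedding g N]
    simp [hN, Set.preimage]
  have hcompact : IsCompact N := by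
    refine (isCompact_closedBall (0 : EuclideanSpace ℝ (Fin 2)) δ).of_isClosed_subset ?_ ?_
    · exact (isClosed_le continuous_const continuous_norm).inter
        (isClosed_le continuous_norm continuous_const)
    · intro h hh; simpa using hh.2
  have hg : ∀ R : EuclideanSpace ℝ (Fin 2) ≃ₗᵢ[ℝ] EuclideanSpace ℝ (Fin 2),
      IntegrableOn (fun h => g (R h)) N := by
    intro R
    refine ContinuousOn.integrableOn_compact hcompact ?_
    have hR := R.continuous
    simp only [g, R.norm_map]
    refine ContinuousOn.div (by fun_prop) ?_ ?_
    · exact continuous_norm.continuousOn.rpow_const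
        fun h hh => Or.inl (hε.trans_le hh.1).ne'
    · exact fun h hh => (Real.rpow_pos_of_pos (hε.trans_le hh.1) p).ne'
  let R₀ := LinearIsometryEquiv.refl ℝ (EuclideanSpace ℝ (Fin 2))
  let R₁ := quarterTurn
  let R₂ := LinearIsometryEquiv.neg ℝ (E := EuclideanSpace ℝ (Fin 2))
  let R₃ := quarterTurn.trans (LinearIsometryEquiv.neg ℝ)
  have hsum : ∫ h in N, crossDiff u x h / ‖h‖ ^ p =
      ∫ h in N, -(((g (R₀ h) + g (R₁ h)) + g (R₂ h)) + g (R₃ h)) := by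
    congr 1
    ext h
    simp [g, R₀, R₁, R₂, R₃, crossDiff]
    ring
  have h₀₁ : IntegrableOn (fun h => g (R₀ h) + g (R₁ h)) N := (hg R₀).add (hg R₁)
  have h₀₁₂ : IntegrableOn (fun h => g (R₀ h) + g (R₁ h) + g (R₂ h)) N := h₀₁.add (hg R₂)
  rw [hshift, hsum, integral_neg, integral_add h₀₁₂ (hg R₃), integral_add h₀₁ (hg R₂),
    integral_add (hg R₀) (hg R₁),
    hrot, hrot, hrot, hrot]
  ring

section Kernel

variable {s : ℝ} {u : EuclideanSpace ℝ (Fin 2) → ℝ} {x : EuclideanSpace ℝ (Fin 2)}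

theorem aestronglyMeasurable_crossDiff_div (hu : Continuous u) (p : ℝ)
    (μ : Measure (EuclideanSpace ℝ (Fin 2))) :
    AEStronglyMeasurable (fun h => crossDiff u x h / ‖h‖ ^ p) μ :=
  ((continuous_crossDiff hu x).measurable.div
    (measurable_norm.pow_const p)).aestronglyMeasurable

theorem abs_div_rpow_le {a b C : ℝ} (hb : 0 ≤ b) (hC : 0 ≤ C) (h : |a| ≤ C * b ^ 2) :
    |a / b ^ (2 + 2 * s)| ≤ C * b ^ (-(2 * s)) := by
  rcases hb.eq_or_lt with rfl | hb
  · have : a = 0 := by simpa using h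
    simp only [this, zero_div, abs_zero]
    positivity
  · rw [← sq_div_rpow_eq hb, abs_div, abs_of_pos (Real.rpow_pos_of_pos hb _), ← mul_div_assoc]
    gcongr

theorem integrableOn_crossDiff_div (hs : s < 1) (hu : Differentiable ℝ u)
    (hu' : DifferentiableAt ℝ (fderiv ℝ u) x) {δ : ℝ} (hδ : 0 ≤ δ) :
    IntegrableOn (fun h => crossDiff u x h / ‖h‖ ^ (2 + 2 * s)) (Metric.closedBall 0 δ) := by
  obtain ⟨C, hC, H⟩ := crossDiff_le_on_closedBall hu hu' δ
  refine ((integrableOn_norm_rpow_closedBall hs hδ).const_mul C).mono'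
    (aestronglyMeasurable_crossDiff_div hu.continuous _ _) ?_
  exact (ae_restrict_iff' measurableSet_closedBall).2
    (ae_of_all _ fun h hh => abs_div_rpow_le (norm_nonneg h) hC (H h hh))

theorem tendsto_integral_annulus {k : EuclideanSpace ℝ (Fin 2) → ℝ} (hk0 : k 0 = 0) {δ : ℝ}
    (hk : IntegrableOn k (Metric.closedBall 0 δ)) :
    Tendsto (fun ε : ℝ => ∫ h in {h : EuclideanSpace ℝ (Fin 2) | ε ≤ ‖h‖ ∧ ‖h‖ ≤ δ}, k h)
      (nhdsWithin 0 (Set.Ioi 0)) (nhds (∫ h in Metric.closedBall 0 δ, k h)) := by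
  have hmeas : ∀ ε : ℝ, MeasurableSet {h : EuclideanSpace ℝ (Fin 2) | ε ≤ ‖h‖} :=
    fun ε => measurableSet_le measurable_const measurable_norm
  have heq : ∀ ε : ℝ, ∫ h in {h : EuclideanSpace ℝ (Fin 2) | ε ≤ ‖h‖ ∧ ‖h‖ ≤ δ}, k h =
      ∫ h in Metric.closedBall 0 δ, {h | ε ≤ ‖h‖}.indicator k h := by
    intro ε
    rw [integral_indicator (hmeas ε), Measure.restrict_restrict (hmeas ε)]
    congr 2
    ext h
    simp
  simp_rw [heq]
  refine tendsto_integral_filter_of_dominated_convergence (fun h => ‖k h‖)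
    (Eventually.of_forall fun ε => hk.aestronglyMeasurable.indicator (hmeas ε))
    (Eventually.of_forall fun ε => ae_of_all _ fun h => norm_indicator_le_norm_self _ _)
    hk.norm (ae_of_all _ fun h => ?_)
  refine tendsto_const_nhds.congr' ?_
  rcases eq_or_ne h 0 with rfl | hh
  · exact Eventually.of_forall fun ε => by simp [Set.indicator, hk0]
  · filter_upwards [nhdsWithin_le_nhds (Iio_mem_nhds (norm_pos_iff.2 hh))] with ε hε
    simp [Set.indicator, le_of_lt (Set.mem_Iio.1 hε)]

theorem tendsto_scaled_integral_crossDiff (hs : s < 1) (hu : Differentiable ℝ u)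
    (hu' : DifferentiableAt ℝ (fderiv ℝ u) x) :
    Tendsto (fun δ : ℝ => (2 - 2 * s) / (2 * Real.pi * δ ^ (2 - 2 * s)) *
      ∫ h in Metric.closedBall 0 δ, crossDiff u x h / ‖h‖ ^ (2 + 2 * s))
      (nhdsWithin 0 (Set.Ioi 0)) (nhds (laplacian2 u x)) := by
  rw [Metric.tendsto_nhds]
  intro η hη
  obtain ⟨r, hr, H⟩ := crossDiff_sub_laplacian2_le hu hu' (half_pos hη)
  filter_upwards [nhdsWithin_le_nhds (Iio_mem_nhds hr), self_mem_nhdsWithin] with δ hδr hδ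
  rw [Set.mem_Iio] at hδr
  rw [Set.mem_Ioi] at hδ
  set c := (2 - 2 * s) / (2 * Real.pi * δ ^ (2 - 2 * s)) with hc
  have hδp := Real.rpow_pos_of_pos hδ (2 - 2 * s)
  have hs2 : 0 < 2 - 2 * s := by linarith
  have hc0 : 0 < c := by positivity
  have hI := integral_norm_rpow_closedBall hs hδ.le
  have hint := integrableOn_norm_rpow_closedBall hs hδ.le
  set I := ∫ h in Metric.closedBall (0 : EuclideanSpace ℝ (Fin 2)) δ, ‖h‖ ^ (-(2 * s))
  have hcI : c * I = 1 := by
    have : 1 - s ≠ 0 := (sub_pos.2 hs).ne'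
    rw [hI, hc]
    field_simp
  have hdiff : |(∫ h in Metric.closedBall 0 δ, crossDiff u x h / ‖h‖ ^ (2 + 2 * s)) -
      laplacian2 u x * I| ≤ η / 2 * I := by
    rw [← integral_const_mul, ← integral_sub (integrableOn_crossDiff_div hs hu hu' hδ.le)
      (hint.const_mul _), ← integral_const_mul]
    rw [← Real.norm_eq_abs]
    refine norm_integral_le_of_norm_le (hint.const_mul _) ?_
    have hne : ∀ᵐ h : EuclideanSpace ℝ (Fin 2)
        ∂volume.restrict (Metric.closedBall 0 δ), h ≠ 0 :=
      ae_restrict_of_ae (Measure.ae_ne volume 0)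
    filter_upwards [hne, ae_restrict_mem measurableSet_closedBall] with h h0 hh
    have hpos := norm_pos_iff.2 h0
    have h1 := abs_div_rpow_le (s := s) hpos.le (half_pos hη).le
      (H h ((mem_closedBall_zero_iff.1 hh).trans_lt hδr))
    rwa [sub_div, mul_div_assoc, sq_div_rpow_eq hpos] at h1
  rw [Real.dist_eq]
  calc _ = |c * ((∫ h in Metric.closedBall 0 δ, crossDiff u x h / ‖h‖ ^ (2 + 2 * s)) -
        laplacian2 u x * I)| := by
        congr 1
        linear_combination laplacian2 u x * hcI
    _ ≤ c * (η / 2 * I) := by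
        rw [abs_mul, abs_of_pos hc0]
        gcongr
    _ = η / 2 := by linear_combination (η / 2) * hcI
    _ < η := half_lt_self hη

end Kernel

/-- for `u ∈ C³` with bounded third derivatives, the principal value
defining the correctly scaled truncated fractional-type diffusion operator exists
(its value at horizon `δ` is `A δ`), and the operator converges pointwise to the
classical negative Laplacian as the horizon `δ → 0⁺`. -/
theorem truncated_fractional_local_limit
    (s : ℝ) (hs : s ∈ Set.Ioo (0:ℝ) 1)
    (u : EuclideanSpace ℝ (Fin 2) → ℝ) (hu : ContDiff ℝ 3 u)
    (hbd : ∃ M, ∀ x, ‖iteratedFDeriv ℝ 3 u x‖ ≤ M)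
    (x : EuclideanSpace ℝ (Fin 2)) :
    ∃ A : ℝ → ℝ,
      (∀ δ : ℝ, 0 < δ →
        Tendsto (fun ε : ℝ =>
            2 * ((2 - 2*s) / (Real.pi * δ ^ (2 - 2*s))) *
              ∫ y in {y : EuclideanSpace ℝ (Fin 2) | ε ≤ dist y x ∧ dist y x ≤ δ},
                (u x - u y) / dist x y ^ (2 + 2*s))
          (nhdsWithin 0 (Set.Ioi 0)) (nhds (A δ)))
      ∧ Tendsto A (nhdsWithin 0 (Set.Ioi 0)) (nhds (- laplacian2 u x)) := by
  have hd : Differentiable ℝ u := hu.differentiable (by norm_num)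
  have hd' : DifferentiableAt ℝ (fderiv ℝ u) x :=
    (hu.fderiv_right (m := 2) (by norm_num)).differentiable (by norm_num) x
  refine ⟨fun δ => -((2 - 2 * s) / (2 * Real.pi * δ ^ (2 - 2 * s)) *
      ∫ h in Metric.closedBall 0 δ, crossDiff u x h / ‖h‖ ^ (2 + 2 * s)), fun δ hδ => ?_,
    (tendsto_scaled_integral_crossDiff hs.2 hd hd').neg⟩
  have hlim := (tendsto_integral_annulus (by simp [crossDiff_zero])
    (integrableOn_crossDiff_div hs.2 hd hd' hδ.le)).const_mul
      (-((2 - 2 * s) / (2 * Real.pi * δ ^ (2 - 2 * s))))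
  rw [neg_mul] at hlim
  refine hlim.congr' ?_
  filter_upwards [self_mem_nhdsWithin] with ε hε
  rw [integral_annulus_eq_crossDiff hu.continuous x _ hε, mul_assoc 2 Real.pi, ← div_div]
  ring
end
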